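/- arXiv:2308.04634 — 2 statements merged into one kernel-verified Lean document; each statement's English description precedes it below -/
import Mathlib

section
/- Suppose U has a global minimum at 0 with U(0) = 0 and L-Lipschitz gradient, and L^{1/2}γ⁻¹ ≤ 1/10 and γh ≤ 1. Then for all z = (x,v), z̃ = (x̃,ṽ) ∈ ℝ^{2d} and all a₁, a₂, ã₁, ã₂ ∈ ℝ^d satisfying the one-shot relation O_{h/2}(a₂)∘θ_h∘O_{h/2}(a₁)(z) = O_{h/2}(ã₂)∘θ_h∘O_{h/2}(ã₁)(z̃), it holds that |a₁ − ã₁|² ≤ (181/(30·γ³h³))·(γ²|x − x̃|² + |v − ṽ|²). -/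
open Real MeasureTheory

/-- The half Ornstein–Uhlenbeck step `O_{h/2}(b)(x,v) = (x, e^{−γh/2} v + (1−e^{−γh})^{1/2} b)`. -/
noncomputable def OUhalf {d : ℕ} (γ h : ℝ) (b : EuclideanSpace ℝ (Fin d))
    (z : EuclideanSpace ℝ (Fin d) × EuclideanSpace ℝ (Fin d)) :
    EuclideanSpace ℝ (Fin d) × EuclideanSpace ℝ (Fin d) :=
  (z.1, Real.exp (-(γ * h) / 2) • z.2 + Real.sqrt (1 - Real.exp (-(γ * h))) • b)

/-- The velocity Verlet map `θ_h = θ^{(A)}_{h/2} ∘ θ^{(B)}_h ∘ θ^{(A)}_{h/2}`. -/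
noncomputable def verlet {d : ℕ} (U : EuclideanSpace ℝ (Fin d) → ℝ) (h : ℝ)
    (z : EuclideanSpace ℝ (Fin d) × EuclideanSpace ℝ (Fin d)) :
    EuclideanSpace ℝ (Fin d) × EuclideanSpace ℝ (Fin d) :=
  let z₁ := (z.1 + (h / 2) • z.2, z.2)
  let z₂ := (z₁.1, z₁.2 - h • gradient U z₁.1)
  (z₂.1 + (h / 2) • z₂.2, z₂.2)

/-- If two Verlet steps reach the same position, then the initial position difference `X` and
velocity difference `W` satisfy `X + h W = (h²/2) G` with `G` the gradient difference at the
midpoints. -/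
lemma verlet_fst_eq {d : ℕ} {U : EuclideanSpace ℝ (Fin d) → ℝ} {h : ℝ}
    {z z' : EuclideanSpace ℝ (Fin d) × EuclideanSpace ℝ (Fin d)}
    (hz : (verlet U h z).1 = (verlet U h z').1) :
    (z.1 - z'.1) + h • (z.2 - z'.2) = (h ^ 2 / 2) •
      (gradient U (z.1 + (h / 2) • z.2) - gradient U (z'.1 + (h / 2) • z'.2)) := by
  simp only [verlet] at hz
  rw [← sub_eq_zero] at hz ⊢
  rw [← hz]
  module

/-- `1 - exp (-t) ≥ t / 2` on `[0, 1]`. -/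
lemma half_le_one_sub_exp_neg {t : ℝ} (ht0 : 0 ≤ t) (ht1 : t ≤ 1) :
    t / 2 ≤ 1 - Real.exp (-t) := by
  have h1 : 1 + t ≤ Real.exp t := by linarith [Real.add_one_le_exp t]
  have h2 : Real.exp (-t) * Real.exp t = 1 := by rw [← Real.exp_add]; simp
  have h3 : Real.exp (-t) * (1 + t) ≤ 1 := by
    exact (mul_le_mul_of_nonneg_left h1 (Real.exp_pos _).le).trans h2.le
  nlinarith [Real.exp_pos (-t)]

/-- If `X + h W = (h²/2) G` where `|G| ≤ L |X + (h/2) W|` and `L h² ≤ 1/100`, then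
`|h W + X| ≤ |X| / 399`. -/
lemma norm_smul_add_le {E : Type*} [NormedAddCommGroup E] [NormedSpace ℝ E] {X W G : E}
    {L h : ℝ} (hLh : L * h ^ 2 ≤ 1 / 100) (hXW : X + h • W = (h ^ 2 / 2) • G)
    (hG : ‖G‖ ≤ L * ‖X + (h / 2) • W‖) :
    ‖X + h • W‖ ≤ 1 / 399 * ‖X‖ := by
  have hm : X + (h / 2) • W = (1 / 2 : ℝ) • X + (1 / 2 : ℝ) • (X + h • W) := by module
  have hm' : ‖X + (h / 2) • W‖ ≤ 1 / 2 * ‖X‖ + 1 / 2 * ‖X + h • W‖ := by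
    rw [hm]
    refine (norm_add_le _ _).trans (le_of_eq ?_)
    rw [norm_smul, norm_smul]
    norm_num
  have hR : ‖X + h • W‖ = h ^ 2 / 2 * ‖G‖ := by
    rw [hXW, norm_smul, Real.norm_of_nonneg (by positivity)]
  have h1 : h ^ 2 / 2 * ‖G‖ ≤ h ^ 2 / 2 * (L * ‖X + (h / 2) • W‖) := by gcongr
  have h2 : L * h ^ 2 * ‖X + (h / 2) • W‖ ≤ 1 / 100 * ‖X + (h / 2) • W‖ := by gcongr
  nlinarith

/-- part of Lemma `lem:oneshot:a`: under the one-shot relation,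
`|a₁ − ã₁|² ≤ (181/(30 γ³h³)) (γ²|x − x̃|² + |v − ṽ|²)`. -/
theorem oneshot_a1_bound (d : ℕ) (U : EuclideanSpace ℝ (Fin d) → ℝ) (L γ h : ℝ)
    (hU : ContDiff ℝ 1 U) (hL : 0 < L) (hγ : 0 < γ) (hh : 0 < h)
    (hmin : ∀ x, U 0 ≤ U x) (hU0 : U 0 = 0)
    (hLip : ∀ x y, ‖gradient U x - gradient U y‖ ≤ L * ‖x - y‖)
    (hfric : Real.sqrt L * γ⁻¹ ≤ 1 / 10) (hγh : γ * h ≤ 1)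
    (z z' : EuclideanSpace ℝ (Fin d) × EuclideanSpace ℝ (Fin d))
    (a₁ a₂ a₁' a₂' : EuclideanSpace ℝ (Fin d))
    (honeshot : OUhalf γ h a₂ (verlet U h (OUhalf γ h a₁ z))
      = OUhalf γ h a₂' (verlet U h (OUhalf γ h a₁' z'))) :
    ‖a₁ - a₁'‖ ^ 2 ≤
      181 / (30 * γ ^ 3 * h ^ 3) * (γ ^ 2 * ‖z.1 - z'.1‖ ^ 2 + ‖z.2 - z'.2‖ ^ 2) := by
  have ht0 : 0 < γ * h := mul_pos hγ hh
  have hLγ : L ≤ γ ^ 2 / 100 := by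
    have h1 : √L ≤ 1 / 10 * γ := by rwa [← div_eq_mul_inv, div_le_iff₀ hγ] at hfric
    calc L = √L ^ 2 := (Real.sq_sqrt hL.le).symm
      _ ≤ (1 / 10 * γ) ^ 2 := by gcongr
      _ = γ ^ 2 / 100 := by ring
  have hLh : L * h ^ 2 ≤ 1 / 100 := by
    calc L * h ^ 2 ≤ γ ^ 2 / 100 * h ^ 2 := by gcongr
      _ = (γ * h) ^ 2 / 100 := by ring
      _ ≤ 1 ^ 2 / 100 := by gcongr
      _ = 1 / 100 := by norm_num
  have hs := half_le_one_sub_exp_neg ht0.le hγh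
  have hs2 : √(1 - Real.exp (-(γ * h))) ^ 2 = 1 - Real.exp (-(γ * h)) :=
    Real.sq_sqrt (by linarith)
  have hη : Real.exp (-(γ * h) / 2) ≤ 1 := Real.exp_le_one_iff.2 (by linarith)
  have hη0 := Real.exp_pos (-(γ * h) / 2)
  have hfst : (verlet U h (OUhalf γ h a₁ z)).1 = (verlet U h (OUhalf γ h a₁' z')).1 := by
    simpa only [OUhalf] using congrArg Prod.fst honeshot
  have hpos := verlet_fst_eq hfst
  simp only [OUhalf] at hpos
  have hLip' := hLip (z.1 + (h / 2) • (Real.exp (-(γ * h) / 2) • z.2 +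
      √(1 - Real.exp (-(γ * h))) • a₁)) (z'.1 + (h / 2) • (Real.exp (-(γ * h) / 2) • z'.2 +
      √(1 - Real.exp (-(γ * h))) • a₁'))
  rw [add_sub_add_comm, ← smul_sub] at hLip'
  have hR := norm_smul_add_le hLh hpos hLip'
  generalize Real.exp (-(γ * h) / 2) = η at *
  generalize √(1 - Real.exp (-(γ * h))) = s at *
  rw [← hs2] at hs
  have hA : (h * s) • (a₁ - a₁') = ((z.1 - z'.1) + h • ((η • z.2 + s • a₁) - (η • z'.2 + s • a₁')))
      - (z.1 - z'.1) - (h * η) • (z.2 - z'.2) := by module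
  have hA' : ‖(h * s) • (a₁ - a₁')‖ ≤ 400 / 399 * ‖z.1 - z'.1‖ + h * ‖z.2 - z'.2‖ := by
    have hV : ‖(h * η) • (z.2 - z'.2)‖ ≤ h * ‖z.2 - z'.2‖ := by
      rw [norm_smul, Real.norm_of_nonneg (by positivity)]
      gcongr
      exact mul_le_of_le_one_right hh.le hη
    rw [hA]
    refine (norm_sub_le _ _).trans ?_
    linarith [norm_sub_le ((z.1 - z'.1) + h • ((η • z.2 + s • a₁) - (η • z'.2 + s • a₁')))
      (z.1 - z'.1)]
  generalize ‖z.1 - z'.1‖ = x at *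
  generalize ‖z.2 - z'.2‖ = v at *
  have hsq : h ^ 2 * s ^ 2 * ‖a₁ - a₁'‖ ^ 2 ≤ (400 / 399 * x + h * v) ^ 2 := by
    calc h ^ 2 * s ^ 2 * ‖a₁ - a₁'‖ ^ 2 = ‖(h * s) • (a₁ - a₁')‖ ^ 2 := by
          rw [norm_smul, mul_pow, Real.norm_eq_abs, sq_abs, mul_pow]
      _ ≤ _ := by gcongr
  have hlow : h ^ 2 * (γ * h / 2) * ‖a₁ - a₁'‖ ^ 2 ≤ h ^ 2 * s ^ 2 * ‖a₁ - a₁'‖ ^ 2 := by gcongr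
  have hup : γ ^ 2 * (400 / 399 * x + h * v) ^ 2 ≤ 181 / 60 * (γ ^ 2 * x ^ 2 + v ^ 2) := by
    have hv : (γ * h * v) ^ 2 ≤ v ^ 2 := by
      rw [mul_pow]
      exact mul_le_of_le_one_left (sq_nonneg v) (pow_le_one₀ ht0.le hγh)
    nlinarith [sq_nonneg (γ * x - γ * h * v), sq_nonneg (γ * x), sq_nonneg v]
  have hmain : γ ^ 2 * (h ^ 2 * (γ * h / 2) * ‖a₁ - a₁'‖ ^ 2) ≤
      181 / 60 * (γ ^ 2 * x ^ 2 + v ^ 2) :=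
    (mul_le_mul_of_nonneg_left (hlow.trans hsq) (sq_nonneg γ)).trans hup
  rw [div_mul_eq_mul_div, le_div_iff₀ (by positivity)]
  linarith
end

section
/- Suppose U has a global minimum at 0 with U(0) = 0 and L-Lipschitz gradient, U ∈ C³ with |∇³U(x)⋮(a⊗b⊗c)| ≤ L_H|a||b||c| for all x,a,b,c ∈ ℝ^d, and L^{1/2}γ⁻¹ ≤ 1/10 and γh ≤ 1. Fix z = (x,v), z̃ = (x̃,ṽ) ∈ ℝ^{2d} and let Φ : ℝ^{2d} → ℝ^{2d} be a differentiable map such that O_{h/2}(a₂)∘θ_h∘O_{h/2}(a₁)(z) = O_{h/2}(ã₂)∘θ_h∘O_{h/2}(ã₁)(z̃) whenever (ã₁,ã₂) = Φ(a₁,a₂). Then for all a₁, a₂ ∈ ℝ^d, tr(DΦ(a₁,a₂) − I_{2d}) − log|det DΦ(a₁,a₂)| ≤ 2d·(L_H h³)²/(γ²h²)·(γ²|x − x̃|² + |v − ṽ|²). -/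
open Real MeasureTheory

/-- Trace and determinant of an endomorphism of a product that is block lower triangular with
identity lower right block. -/
lemma LinearMap.toMatrix_prod_of_lower_triangular {E ι : Type*} [AddCommGroup E] [Module ℝ E]
    [Fintype ι] [DecidableEq ι] (b : Module.Basis ι ℝ E) (f : E × E →ₗ[ℝ] E × E)
    (hf : ∀ w, f (0, w) = (0, w)) :
    ∃ C, LinearMap.toMatrix (b.prod b) (b.prod b) f = Matrix.fromBlocks
      (LinearMap.toMatrix b b (LinearMap.fst ℝ E E ∘ₗ f ∘ₗ LinearMap.inl ℝ E E)) 0 C 1 := by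
  refine ⟨LinearMap.toMatrix b b (LinearMap.snd ℝ E E ∘ₗ f ∘ₗ LinearMap.inl ℝ E E), ?_⟩
  ext (i | i) (j | j) <;>
    simp [LinearMap.toMatrix_apply, hf, Matrix.one_apply, Finsupp.single_apply, eq_comm]

lemma LinearMap.det_of_lower_triangular {E : Type*} [AddCommGroup E] [Module ℝ E]
    [FiniteDimensional ℝ E] (f : E × E →ₗ[ℝ] E × E) (hf : ∀ w, f (0, w) = (0, w)) :
    LinearMap.det f =
      LinearMap.det (LinearMap.fst ℝ E E ∘ₗ f ∘ₗ LinearMap.inl ℝ E E) := by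
  classical
  set b := Module.finBasis ℝ E
  obtain ⟨C, hC⟩ := LinearMap.toMatrix_prod_of_lower_triangular b f hf
  rw [← LinearMap.det_toMatrix (b.prod b), hC, Matrix.det_fromBlocks_zero₁₂, Matrix.det_one,
    mul_one, LinearMap.det_toMatrix]

lemma LinearMap.trace_sub_id_of_lower_triangular {E : Type*} [AddCommGroup E] [Module ℝ E]
    [FiniteDimensional ℝ E] (f : E × E →ₗ[ℝ] E × E) (hf : ∀ w, f (0, w) = (0, w)) :
    LinearMap.trace ℝ _ (f - LinearMap.id) =
      LinearMap.trace ℝ _ (LinearMap.fst ℝ E E ∘ₗ f ∘ₗ LinearMap.inl ℝ E E - LinearMap.id) := by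
  classical
  set b := Module.finBasis ℝ E
  obtain ⟨C, hC⟩ := LinearMap.toMatrix_prod_of_lower_triangular b f hf
  rw [map_sub, map_sub, LinearMap.trace_eq_matrix_trace ℝ (b.prod b) f, hC,
    LinearMap.trace_id, LinearMap.trace_id, LinearMap.trace_eq_matrix_trace ℝ b]
  simp [Matrix.trace, Fintype.sum_sum_type]

lemma Complex.re_sub_one_sub_log_norm_le {w : ℂ} {ε : ℝ} (hε : ε ≤ 1 / 2) (hw : ‖w - 1‖ ≤ ε) :
    (w - 1).re - Real.log ‖w‖ ≤ ε ^ 2 := by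
  have h := Complex.norm_log_one_add_sub_self_le (z := w - 1) (by linarith)
  have h1 := (Complex.abs_re_le_norm _).trans h
  rw [add_sub_cancel, Complex.sub_re, Complex.log_re] at h1
  have h0 := norm_nonneg (w - 1)
  have h2 : (1 - ‖w - 1‖)⁻¹ ≤ 2 := by
    rw [inv_le_comm₀ (by linarith) (by norm_num)]; linarith
  have h3 : ‖w - 1‖ ^ 2 * (1 - ‖w - 1‖)⁻¹ / 2 ≤ ‖w - 1‖ ^ 2 := by
    nlinarith [mul_le_mul_of_nonneg_left h2 (sq_nonneg ‖w - 1‖)]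
  have h4 := pow_le_pow_left₀ h0 hw 2
  linarith [(abs_le.mp h1).1]

/-- Complex eigenvalues of a real matrix that is `ε`-bounded on real vectors have modulus `≤ ε`. -/
lemma Matrix.norm_le_of_map_ofReal_mulVec_eq_smul {n : Type*} [Fintype n] {M : Matrix n n ℝ}
    {ε : ℝ} (hε : 0 ≤ ε)
    (hM : ∀ v : n → ℝ, ∑ i, (M.mulVec v) i ^ 2 ≤ ε ^ 2 * ∑ i, v i ^ 2)
    {w : ℂ} {u : n → ℂ} (hu : u ≠ 0) (h : (M.map Complex.ofReal).mulVec u = w • u) :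
    ‖w‖ ≤ ε := by
  have hre : ∀ i, (M.mulVec fun j ↦ (u j).re) i = w.re * (u i).re - w.im * (u i).im := by
    intro i
    simpa [Matrix.mulVec, dotProduct] using congr_arg Complex.re (congr_fun h i)
  have him : ∀ i, (M.mulVec fun j ↦ (u j).im) i = w.re * (u i).im + w.im * (u i).re := by
    intro i
    simpa [Matrix.mulVec, dotProduct] using congr_arg Complex.im (congr_fun h i)
  have hsum := add_le_add (hM fun j ↦ (u j).re) (hM fun j ↦ (u j).im)
  simp only [hre, him, ← mul_add, ← Finset.sum_add_distrib] at hsum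
  have hw : ∀ i, (w.re * (u i).re - w.im * (u i).im) ^ 2 + (w.re * (u i).im + w.im * (u i).re) ^ 2
      = ‖w‖ ^ 2 * ((u i).re ^ 2 + (u i).im ^ 2) := by
    intro i
    rw [← Complex.normSq_eq_norm_sq, Complex.normSq_apply]; ring
  simp only [hw, ← Finset.mul_sum] at hsum
  have hpos : 0 < ∑ i, ((u i).re ^ 2 + (u i).im ^ 2) := by
    obtain ⟨i, hi⟩ := Function.ne_iff.mp hu
    refine Finset.sum_pos' (fun j _ ↦ by positivity) ⟨i, Finset.mem_univ i, ?_⟩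
    have := Complex.normSq_pos.mpr hi
    rw [Complex.normSq_apply] at this
    nlinarith
  exact pow_le_pow_iff_left₀ (norm_nonneg w) hε two_ne_zero |>.mp (le_of_mul_le_mul_right hsum hpos)

lemma Multiset.sum_sub_one_re_sub_log_norm_prod_le {s : Multiset ℂ} {ε : ℝ} (hε : ε ≤ 1 / 2)
    (hs : ∀ w ∈ s, ‖w - 1‖ ≤ ε) :
    s.sum.re - s.card - Real.log ‖s.prod‖ ≤ s.card * ε ^ 2 := by
  induction s using Multiset.induction_on with
  | empty => simp
  | cons a s ih =>
    have ih := ih fun w hw ↦ hs w (Multiset.mem_cons_of_mem hw)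
    have ha := Complex.re_sub_one_sub_log_norm_le hε (hs a (Multiset.mem_cons_self a s))
    have hne : ∀ w ∈ a ::ₘ s, w ≠ 0 := by
      rintro w hw rfl
      have := hs 0 hw
      norm_num at this
      linarith
    have ha0 := hne a (Multiset.mem_cons_self a s)
    have hs0 : s.prod ≠ 0 := Multiset.prod_ne_zero fun h ↦
      hne 0 (Multiset.mem_cons_of_mem h) rfl
    rw [Multiset.sum_cons, Multiset.prod_cons, Multiset.card_cons, norm_mul,
      Real.log_mul (norm_ne_zero_iff.mpr ha0) (norm_ne_zero_iff.mpr hs0), Complex.add_re]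
    rw [Complex.sub_re, Complex.one_re] at ha
    push_cast
    linarith

/-- If `‖A - 1‖ ≤ ε ≤ 1/2`, then `tr (A - 1) - log |det A| ≤ d ε²`. -/
lemma LinearMap.trace_sub_id_sub_log_abs_det_le {d : ℕ}
    (A : EuclideanSpace ℝ (Fin d) →ₗ[ℝ] EuclideanSpace ℝ (Fin d)) {ε : ℝ} (hε₀ : 0 ≤ ε)
    (hε : ε ≤ 1 / 2) (hA : ∀ u, ‖A u - u‖ ≤ ε * ‖u‖) :
    LinearMap.trace ℝ _ (A - LinearMap.id) - Real.log |LinearMap.det A| ≤ d * ε ^ 2 := by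
  set b := (EuclideanSpace.basisFun (Fin d) ℝ).toBasis
  set M := LinearMap.toMatrix b b A
  set N := M.map Complex.ofReal
  have htr : LinearMap.trace ℝ _ (A - LinearMap.id) = N.charpoly.roots.sum.re - d := by
    rw [← Matrix.trace_eq_sum_roots_charpoly, map_sub, LinearMap.trace_id,
      LinearMap.trace_eq_matrix_trace ℝ b]
    simp [N, M, Matrix.trace]
  have hdet : |LinearMap.det A| = ‖N.charpoly.roots.prod‖ := by
    rw [← Matrix.det_eq_prod_roots_charpoly, ← LinearMap.det_toMatrix b]
    have : N.det = ((M.det : ℝ) : ℂ) := (RingHom.map_det Complex.ofRealHom M).symm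
    rw [this, Complex.norm_real, Real.norm_eq_abs]
  have hcard : N.charpoly.roots.card = d := by
    rw [IsAlgClosed.card_roots_eq_natDegree, Matrix.charpoly_natDegree_eq_dim, Fintype.card_fin]
  have hM : ∀ v : Fin d → ℝ, ∑ i, ((M - 1).mulVec v) i ^ 2 ≤ ε ^ 2 * ∑ i, v i ^ 2 := by
    intro v
    have h := pow_le_pow_left₀ (norm_nonneg _) (hA (WithLp.toLp 2 v)) 2
    have hv : ∀ i, (M.mulVec v) i = A (WithLp.toLp 2 v) i := by
      intro i
      exact congr_fun (LinearMap.toMatrix_mulVec_repr b b A (WithLp.toLp 2 v)) i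
    rw [mul_pow, EuclideanSpace.norm_sq_eq, EuclideanSpace.norm_sq_eq] at h
    simpa [Matrix.sub_mulVec, hv] using h
  have hroots : ∀ w ∈ N.charpoly.roots, ‖w - 1‖ ≤ ε := by
    intro w hw
    have hw := Polynomial.isRoot_of_mem_roots hw
    rw [Polynomial.IsRoot, Matrix.eval_charpoly] at hw
    obtain ⟨u, hu0, hu⟩ := Matrix.exists_mulVec_eq_zero_iff.mpr hw
    refine Matrix.norm_le_of_map_ofReal_mulVec_eq_smul hε₀ hM hu0 ?_
    have hN : (M - 1).map Complex.ofReal = N - 1 := by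
      ext i j
      simp [N, Matrix.one_apply, apply_ite Complex.ofReal]
    rw [hN, Matrix.sub_mulVec, Matrix.one_mulVec, sub_smul, one_smul]
    rw [Matrix.sub_mulVec, sub_eq_zero] at hu
    rw [← hu]
    simp
  have := Multiset.sum_sub_one_re_sub_log_norm_prod_le hε hroots
  rwa [hcard, ← htr, ← hdet] at this

lemma ContDiff.hasFDerivAt_gradient {E : Type*} [NormedAddCommGroup E] [InnerProductSpace ℝ E]
    [CompleteSpace E] {U : E → ℝ} (hU : ContDiff ℝ 2 U) (x : E) :
    HasFDerivAt (gradient U) (fderiv ℝ (gradient U) x) x := by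
  have h : Differentiable ℝ (fderiv ℝ U) :=
    (hU.fderiv_right (m := 1) le_rfl).differentiable one_ne_zero
  exact ((InnerProductSpace.toDual ℝ E).symm.differentiable.comp h x).hasFDerivAt

lemma inner_fderiv_gradient {E : Type*} [NormedAddCommGroup E] [InnerProductSpace ℝ E]
    [CompleteSpace E] {U : E → ℝ} (hU : ContDiff ℝ 2 U) (x u v : E) :
    inner ℝ (fderiv ℝ (gradient U) x u) v = fderiv ℝ (fderiv ℝ U) x u v := by
  have h : Differentiable ℝ (fderiv ℝ U) :=
    (hU.fderiv_right (m := 1) le_rfl).differentiable one_ne_zero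
  have h1 := (hU.hasFDerivAt_gradient x).inner ℝ (hasFDerivAt_const v x)
  have h2 := (h x).hasFDerivAt.clm_apply (hasFDerivAt_const v x)
  have := h1.unique (h2.congr_of_eventuallyEq (.of_forall fun y ↦ inner_gradient_left))
  simpa using DFunLike.congr_fun this u

/-- A bound on the third derivative of `U` is a Lipschitz bound on its Hessian. -/
lemma norm_fderiv_gradient_sub_apply_le {E : Type*} [NormedAddCommGroup E]
    [InnerProductSpace ℝ E] [CompleteSpace E] {U : E → ℝ} (hU : ContDiff ℝ 3 U) {K : ℝ}
    (hK : 0 ≤ K) (hbound : ∀ x a b c : E,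
      |iteratedFDeriv ℝ 3 U x ![a, b, c]| ≤ K * ‖a‖ * ‖b‖ * ‖c‖) (x y u : E) :
    ‖fderiv ℝ (gradient U) x u - fderiv ℝ (gradient U) y u‖ ≤ K * ‖x - y‖ * ‖u‖ := by
  have hU2 : ContDiff ℝ 2 U := hU.of_le (by norm_num)
  have hd : Differentiable ℝ (fderiv ℝ (fderiv ℝ U)) :=
    ((hU.fderiv_right (m := 2) le_rfl).fderiv_right (m := 1) le_rfl).differentiable one_ne_zero
  have hlip : ∀ v, |fderiv ℝ (fderiv ℝ U) x u v - fderiv ℝ (fderiv ℝ U) y u v|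
      ≤ K * ‖u‖ * ‖v‖ * ‖x - y‖ := by
    intro v
    refine Convex.norm_image_sub_le_of_norm_hasFDerivWithin_le (𝕜 := ℝ) (s := Set.univ)
      (fun z _ ↦ (((hd z).hasFDerivAt.clm_apply (hasFDerivAt_const u z)).clm_apply
        (hasFDerivAt_const v z)).hasFDerivWithinAt) (fun z _ ↦ ?_) convex_univ
      (Set.mem_univ y) (Set.mem_univ x)
    refine ContinuousLinearMap.opNorm_le_bound _ (by positivity) fun a ↦ ?_
    have := hbound z a u v
    rw [iteratedFDeriv_succ_apply_right, iteratedFDeriv_two_apply] at this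
    calc _ = |fderiv ℝ (fderiv ℝ (fderiv ℝ U)) z a u v| := by simp
      _ ≤ K * ‖a‖ * ‖u‖ * ‖v‖ := this
      _ = _ := by ring
  set r := fderiv ℝ (gradient U) x u - fderiv ℝ (gradient U) y u with hr
  have h := (le_abs_self _).trans (hlip r)
  rw [← inner_fderiv_gradient hU2, ← inner_fderiv_gradient hU2, ← inner_sub_left, ← hr,
    real_inner_self_eq_norm_sq] at h
  rcases (norm_nonneg r).eq_or_lt with h0 | h0
  · rw [← h0]; positivity
  · nlinarith

/-- Directional derivative of one step `O_{h/2} ∘ θ_h ∘ O_{h/2}` in the two noise variables. -/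
lemma hasDerivAt_OUhalf_verlet_OUhalf {d : ℕ} {U : EuclideanSpace ℝ (Fin d) → ℝ}
    (hU : ContDiff ℝ 2 U) (γ h : ℝ)
    (z : EuclideanSpace ℝ (Fin d) × EuclideanSpace ℝ (Fin d))
    {c : ℝ → EuclideanSpace ℝ (Fin d) × EuclideanSpace ℝ (Fin d)}
    {c' : EuclideanSpace ℝ (Fin d) × EuclideanSpace ℝ (Fin d)} {t : ℝ} (hc : HasDerivAt c c' t) :
    let η := Real.exp (-(γ * h) / 2)
    let σ := Real.sqrt (1 - Real.exp (-(γ * h)))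
    let H := fderiv ℝ (gradient U) (z.1 + (h / 2) • (η • z.2 + σ • (c t).1))
    HasDerivAt (fun s ↦ OUhalf γ h (c s).2 (verlet U h (OUhalf γ h (c s).1 z)))
      ((h * σ) • (c'.1 - (h ^ 2 / 4) • H c'.1),
        (η * σ) • (c'.1 - (h ^ 2 / 2) • H c'.1) + σ • c'.2) t := by
  intro η σ H
  have h1 : HasDerivAt (fun s ↦ (c s).1) c'.1 t := hc.fst
  have h2 : HasDerivAt (fun s ↦ (c s).2) c'.2 t := hc.snd
  have hV := (h1.const_smul σ).const_add (η • z.2)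
  have hX := (hV.const_smul (h / 2)).const_add z.1
  have hg := ((hU.hasFDerivAt_gradient _).comp_hasDerivAt t hX).const_smul h
  have hW := hV.sub hg
  have := (hX.add (hW.const_smul (h / 2))).prodMk ((hW.const_smul η).add (h2.const_smul σ))
  refine HasDerivAt.congr_deriv this (Prod.ext ?_ ?_)
  · change (h / 2) • σ • c'.1 + (h / 2) • (σ • c'.1 - h • H ((h / 2) • σ • c'.1)) =
      (h * σ) • (c'.1 - (h ^ 2 / 4) • H c'.1)
    rw [map_smul, map_smul]
    module
  · change η • (σ • c'.1 - h • H ((h / 2) • σ • c'.1)) + σ • c'.2 =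
      (η * σ) • (c'.1 - (h ^ 2 / 2) • H c'.1) + σ • c'.2
    rw [map_smul, map_smul]
    module

/-- Stability of `e - s • f = r` when `f` is bounded by a small multiple of `e`. -/
lemma norm_le_of_sub_smul_eq {E : Type*} [NormedAddCommGroup E] [NormedSpace ℝ E]
    {e f r : E} {s K : ℝ} (hs : 0 ≤ s) (hK : s * K ≤ 1 / 400) (hf : ‖f‖ ≤ K * ‖e‖)
    (h : e - s • f = r) : ‖e‖ ≤ 400 / 399 * ‖r‖ := by
  have h1 : ‖e‖ ≤ ‖r‖ + s * ‖f‖ := by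
    rw [← norm_smul_of_nonneg hs, ← h]
    simpa using norm_add_le (e - s • f) (s • f)
  nlinarith [mul_le_mul_of_nonneg_left hf hs, norm_nonneg e]

/-- Lemma `lem:oneshot:b`: for the one-shot map `Φ`,
`tr(DΦ − I_{2d}) − log|det DΦ| ≤ 2 d (L_H h³)²/(γ²h²) · ‖z − z̃‖²`. -/
theorem oneshot_jacobian_bound (d : ℕ) (U : EuclideanSpace ℝ (Fin d) → ℝ)
    (L L_H γ h : ℝ)
    (hU : ContDiff ℝ 3 U) (hL : 0 < L) (hLH : 0 ≤ L_H) (hγ : 0 < γ) (hh : 0 < h)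
    (hmin : ∀ x, U 0 ≤ U x) (hU0 : U 0 = 0)
    (hLip : ∀ x y, ‖gradient U x - gradient U y‖ ≤ L * ‖x - y‖)
    (hHess : ∀ x a b c : EuclideanSpace ℝ (Fin d),
      |iteratedFDeriv ℝ 3 U x ![a, b, c]| ≤ L_H * ‖a‖ * ‖b‖ * ‖c‖)
    (hfric : Real.sqrt L * γ⁻¹ ≤ 1 / 10) (hγh : γ * h ≤ 1)
    (z z' : EuclideanSpace ℝ (Fin d) × EuclideanSpace ℝ (Fin d))
    (Φ : EuclideanSpace ℝ (Fin d) × EuclideanSpace ℝ (Fin d) →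
      EuclideanSpace ℝ (Fin d) × EuclideanSpace ℝ (Fin d))
    (hΦdiff : Differentiable ℝ Φ)
    (hΦ : ∀ a₁ a₂ : EuclideanSpace ℝ (Fin d),
      OUhalf γ h a₂ (verlet U h (OUhalf γ h a₁ z))
        = OUhalf γ h (Φ (a₁, a₂)).2 (verlet U h (OUhalf γ h (Φ (a₁, a₂)).1 z')))
    (a₁ a₂ : EuclideanSpace ℝ (Fin d)) :
    LinearMap.trace ℝ _ ((fderiv ℝ Φ (a₁, a₂)).toLinearMap - LinearMap.id)
        - Real.log |LinearMap.det (fderiv ℝ Φ (a₁, a₂)).toLinearMap| ≤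
      2 * d * (L_H * h ^ 3) ^ 2 / (γ ^ 2 * h ^ 2) *
        (γ ^ 2 * ‖z.1 - z'.1‖ ^ 2 + ‖z.2 - z'.2‖ ^ 2) := by
  set η := Real.exp (-(γ * h) / 2) with hη
  set σ := Real.sqrt (1 - Real.exp (-(γ * h))) with hσ
  have hσ0 : 0 < σ := Real.sqrt_pos.mpr
    (sub_pos.mpr (Real.exp_lt_one_iff.mpr (neg_lt_zero.mpr (mul_pos hγ hh))))
  have hU2 : ContDiff ℝ 2 U := hU.of_le (by norm_num)
  set s := h ^ 2 / 4 with hs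
  have hs0 : 0 < s := by positivity
  have hsL : s * L ≤ 1 / 400 := by
    have h1 : Real.sqrt L ≤ 1 / 10 * γ := by
      rwa [← div_eq_mul_inv, div_le_iff₀ hγ] at hfric
    have h2 : Real.sqrt L * h ≤ 1 / 10 := by nlinarith
    have h3 := pow_le_pow_left₀ (by positivity) h2 2
    rw [mul_pow, Real.sq_sqrt hL.le] at h3
    rw [hs]; linarith
  set D := fderiv ℝ Φ (a₁, a₂) with hD
  set X := z.1 + (h / 2) • (η • z.2 + σ • a₁) with hX
  set Y := z'.1 + (h / 2) • (η • z'.2 + σ • (Φ (a₁, a₂)).1) with hY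
  set g := gradient U with hg
  have hnormH : ∀ x u, ‖fderiv ℝ g x u‖ ≤ L * ‖u‖ := fun x u ↦
    (fderiv ℝ g x).le_of_opNorm_le (norm_fderiv_le_of_lipschitz ℝ (C := ⟨L, hL.le⟩)
      (LipschitzWith.of_dist_le_mul fun x y ↦ by rw [dist_eq_norm, dist_eq_norm]; exact hLip x y)) u
  have hXY : ‖X - Y‖ ≤ 400 / 399 * ((1 / 2) * ‖z.1 - z'.1‖) := by
    have h1 := congr_arg Prod.fst (hΦ a₁ a₂)
    simp only [OUhalf, verlet] at h1
    rw [← hη, ← hσ, ← hX, ← hY, ← hg] at h1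
    have := norm_le_of_sub_smul_eq hs0.le hsL (hLip X Y)
      (r := (1 / 2 : ℝ) • (z.1 - z'.1)) ?_
    · simpa [norm_smul] using this
    · have hVX : (h / 2) • (η • z.2 + σ • a₁) = X - z.1 := by rw [hX]; abel
      have hVY : (h / 2) • (η • z'.2 + σ • (Φ (a₁, a₂)).1) = Y - z'.1 := by rw [hY]; abel
      rw [smul_sub, smul_sub, hVX, hVY] at h1
      rw [hs]
      linear_combination (norm := module) (1 / 2 : ℝ) • h1
  have hder : ∀ p : EuclideanSpace ℝ (Fin d) × EuclideanSpace ℝ (Fin d),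
      p.1 - s • fderiv ℝ g X p.1 = (D p).1 - s • fderiv ℝ g Y (D p).1 ∧
      η • (p.1 - (h ^ 2 / 2) • fderiv ℝ g X p.1) + p.2 =
        η • ((D p).1 - (h ^ 2 / 2) • fderiv ℝ g Y (D p).1) + (D p).2 := by
    intro p
    have hc : HasDerivAt (fun t : ℝ ↦ (a₁, a₂) + t • p) p 0 := by
      simpa using ((hasDerivAt_id (0 : ℝ)).smul_const p).const_add (a₁, a₂)
    have hΦc : HasDerivAt (fun t : ℝ ↦ Φ ((a₁, a₂) + t • p)) (D p) 0 :=
      HasFDerivAt.comp_hasDerivAt (0 : ℝ) (by simpa [hD] using (hΦdiff _).hasFDerivAt) hc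
    have h1 := hasDerivAt_OUhalf_verlet_OUhalf hU2 γ h z hc
    have h2 := hasDerivAt_OUhalf_verlet_OUhalf hU2 γ h z' hΦc
    have h3 := h1.unique (h2.congr_of_eventuallyEq (.of_forall fun t ↦ hΦ _ _))
    simp only [zero_smul, add_zero] at h3
    rw [← hη, ← hσ, ← hX, ← hY, ← hg, ← hs, Prod.mk.injEq] at h3
    refine ⟨smul_right_injective _ (mul_pos hh hσ0).ne' h3.1,
      smul_right_injective _ hσ0.ne' ?_⟩
    simpa only [smul_add, smul_smul, mul_comm σ η] using h3.2
  have hlow : ∀ w, D.toLinearMap (0, w) = (0, w) := by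
    intro w
    obtain ⟨h1, h2⟩ := hder (0, w)
    simp only [map_zero, smul_zero, sub_zero] at h1 h2
    have h3 := norm_le_of_sub_smul_eq hs0.le hsL (hnormH Y _) h1.symm
    rw [norm_zero, mul_zero, norm_le_zero_iff] at h3
    simp only [h3, map_zero, smul_zero, sub_zero, zero_add] at h2
    exact Prod.ext h3 h2.symm
  set ε := min (1 / 2) (L_H * h ^ 2 * ‖z.1 - z'.1‖) with hε
  have hε0 : 0 ≤ ε := le_min (by norm_num) (by positivity)
  rw [LinearMap.trace_sub_id_of_lower_triangular _ hlow, LinearMap.det_of_lower_triangular _ hlow]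
  refine (LinearMap.trace_sub_id_sub_log_abs_det_le _ hε0 (min_le_left _ _) fun u ↦ ?_).trans ?_
  · change ‖(D (u, 0)).1 - u‖ ≤ _
    have h1 := norm_le_of_sub_smul_eq hs0.le hsL (hnormH Y ((D (u, 0)).1 - u))
      (r := s • (fderiv ℝ g Y u - fderiv ℝ g X u)) (by
        rw [map_sub]
        linear_combination (norm := module) (-1 : ℝ) • (hder (u, 0)).1)
    rw [norm_smul_of_nonneg hs0.le] at h1
    have h2 : ‖fderiv ℝ g Y u - fderiv ℝ g X u‖ ≤ 2 * (L * ‖u‖) := by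
      linarith [norm_sub_le (fderiv ℝ g Y u) (fderiv ℝ g X u), hnormH X u, hnormH Y u]
    have h3 := norm_fderiv_gradient_sub_apply_le hU hLH hHess Y X u
    have hu := norm_nonneg u
    rw [hε, min_mul_of_nonneg _ _ hu]
    refine le_min ?_ ?_
    · nlinarith [mul_le_mul_of_nonneg_left h2 hs0.le]
    · rw [norm_sub_rev Y X] at h3
      calc _ ≤ _ := h1
        _ ≤ 400 / 399 * (s * (L_H * (400 / 399 * ((1 / 2) * ‖z.1 - z'.1‖)) * ‖u‖)) := by
          gcongr
          exact h3.trans (by gcongr)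
        _ = (400 / 399) ^ 2 / 8 * (L_H * h ^ 2 * ‖z.1 - z'.1‖ * ‖u‖) := by rw [hs]; ring
        _ ≤ 1 * (L_H * h ^ 2 * ‖z.1 - z'.1‖ * ‖u‖) := by gcongr; norm_num
        _ = _ := one_mul _
  · have h1 := pow_le_pow_left₀ hε0 (min_le_right _ _) 2
    calc (d : ℝ) * ε ^ 2 ≤ d * (L_H * h ^ 2 * ‖z.1 - z'.1‖) ^ 2 := by gcongr
      _ ≤ 2 * d * (L_H * h ^ 2 * ‖z.1 - z'.1‖) ^ 2 := by
        nlinarith [mul_nonneg d.cast_nonneg (sq_nonneg (L_H * h ^ 2 * ‖z.1 - z'.1‖))]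
      _ = 2 * d * (L_H * h ^ 3) ^ 2 / (γ ^ 2 * h ^ 2) * (γ ^ 2 * ‖z.1 - z'.1‖ ^ 2) := by
        field_simp
      _ ≤ _ := by
        gcongr
        linarith [sq_nonneg ‖z.2 - z'.2‖]
end
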